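/- arXiv:1202.5454 — 2 statements merged into one kernel-verified Lean document; each statement's English description precedes it below -/
import Mathlib

section
/- For each fixed integer p ≥ 1, the series ∑_{n ≥ p} a(n,p)·12^(-n) converges, where a(n,p) = 3^(n-p)·(3p)!·(2n+p-1)! / (p!·(2p-1)!·(n-p+1)!·(n+2p)!). -/
open Nat Filter Real

/-- The number of rooted quadrangulations of the `2p`-gon with `n` inner faces,
`a(n,p) = 3^(n-p)·(3p)!·(2n+p-1)! / (p!·(2p-1)!·(n-p+1)!·(n+2p)!)`, as a real number. -/
noncomputable def quadCount (n p : ℕ) : ℝ :=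
  (3 : ℝ) ^ (n - p) * ((3 * p)! : ℝ) * ((2 * n + p - 1)! : ℝ) /
    ((p ! : ℝ) * ((2 * p - 1)! : ℝ) * ((n - p + 1)! : ℝ) * ((n + 2 * p)! : ℝ))

theorem qc_rec (q n : ℕ) :
    (quadCount (q+1 + (n+1)) (q+1) / 12 ^ (q+1 + (n+1))) * (4 * (n+2) * (n+3*q+4)) =
    (quadCount (q+1 + n) (q+1) / 12 ^ (q+1 + n)) * ((2*n+3*q+3) * (2*n+3*q+4)) := by
  unfold quadCount
  have e1 : q+1+(n+1)-(q+1) = n+1 := by omega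
  have e2 : q+1+n-(q+1) = n := by omega
  have e3 : 2*(q+1+(n+1))+(q+1)-1 = (2*n+3*q+2)+1+1 := by omega
  have e4 : 2*(q+1+n)+(q+1)-1 = 2*n+3*q+2 := by omega
  have e5 : q+1+(n+1)+2*(q+1) = (n+3*q+3)+1 := by omega
  have e6 : q+1+n+2*(q+1) = n+3*q+3 := by omega
  have e7 : q+1+(n+1) = (q+1+n)+1 := by omega
  rw [e1, e2, e3, e4, e5, e6, e7, Nat.factorial_succ (n+1), Nat.factorial_succ (n+3*q+3),
    Nat.factorial_succ (2*n+3*q+2+1), Nat.factorial_succ (2*n+3*q+2), pow_succ, pow_succ (12:ℝ) (q+1+n)]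
  have h1 : ((q+1)! : ℝ) ≠ 0 := by positivity
  have h2 : ((2*(q+1)-1)! : ℝ) ≠ 0 := by positivity
  have h3 : ((n+1)! : ℝ) ≠ 0 := by positivity
  have h4 : ((n+3*q+3)! : ℝ) ≠ 0 := by positivity
  have h5 : (n:ℝ)+1+1 ≠ 0 := by positivity
  have h6 : (n:ℝ)+3*q+3+1 ≠ 0 := by positivity
  push_cast
  generalize ((q+1)! : ℝ) = A at *
  generalize ((2*(q+1)-1)! : ℝ) = B at *
  generalize ((n+1)! : ℝ) = C at *
  generalize ((n+3*q+3)! : ℝ) = D at *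
  generalize ((2*n+3*q+2)! : ℝ) = E at *
  generalize ((3*(q+1))! : ℝ) = F at *
  have h7 : (12:ℝ)^(q+1+n) ≠ 0 := by positivity
  generalize (12:ℝ)^(q+1+n) = G at *
  generalize (3:ℝ)^n = H at *
  field_simp
  ring

/-- For each fixed `p ≥ 1`, the series `∑_{n ≥ p} a(n,p)·12^(-n)` converges. -/
theorem quadCount_summable (p : ℕ) (hp : 1 ≤ p) :
    Summable (fun n : ℕ => quadCount (p + n) p / 12 ^ (p + n)) := by
  obtain ⟨q, rfl⟩ : ∃ q, p = q + 1 := ⟨p - 1, by omega⟩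
  set b : ℕ → ℝ := fun n => quadCount (q + 1 + n) (q + 1) / 12 ^ (q + 1 + n) with hb
  have b0 : ∀ n, 0 ≤ b n := fun n => by
    simp only [hb, quadCount]; positivity
  have hr : ∀ n : ℕ, b (n+1) * (4 * (n+2) * (n+3*q+4)) = b n * ((2*n+3*q+3) * (2*n+3*q+4)) :=
    fun n => qc_rec q n
  set N : ℕ := (3*q+3)*(3*q+4) with hN
  rw [← summable_nat_add_iff N]
  have key : ∀ n : ℕ, N ≤ n → b n ≤ (n+1) * b n - (n+2) * b (n+1) := by
    intro n hn
    have hn' : ((3*q+3)*(3*q+4) : ℝ) ≤ n := by rw [hN] at hn; exact_mod_cast hn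
    have hD : (0:ℝ) < 4 * (n+3*q+4) := by positivity
    have h1 : (n+2) * b (n+1) * (4 * (n+3*q+4)) = b n * ((2*n+3*q+3) * (2*n+3*q+4)) := by
      rw [← hr]; ring
    have h2 : b n * ((2*n+3*q+3) * (2*n+3*q+4)) ≤ b n * (n * (4 * (n+3*q+4))) := by
      apply mul_le_mul_of_nonneg_left _ (b0 n)
      nlinarith
    have h3 : (n+2) * b (n+1) ≤ n * b n := by
      refine le_of_mul_le_mul_right ?_ hD
      rw [h1]; linarith
    linarith
  have hs : ∀ k : ℕ, ∑ i ∈ Finset.range k, b (i + N) ≤ (N+1) * b N - ((k + N : ℕ) + 1) * b (k + N) := by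
    intro k
    induction k with
    | zero => simp
    | succ k ih =>
      rw [Finset.sum_range_succ]
      have := key (k+N) (by omega)
      have e : k + 1 + N = k + N + 1 := by omega
      rw [e]
      push_cast at *
      linarith
  refine summable_of_sum_range_le (c := (N+1) * b N) (fun n => b0 _) fun k => (hs k).trans ?_
  have := b0 (k+N)
  have : 0 ≤ (((k + N : ℕ):ℝ) + 1) * b (k + N) := by positivity
  linarith
end

section
/- Let g(y) = (y/12)·(1 + y/2)^(-1/2)·(1 − 5y/6)^(-3/2) for real y with |y| < 6/5. Then g is analytic at 0, its Taylor coefficients c_k at 0 are nonnegative, and c_k · (6/5)^k · √(40π/k) → 1 as k → ∞; that is, c_k ~ √(k/(40π))·(5/6)^k. -/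
open Nat Filter Real

/-- The generating function `g(y) = (y/12)·(1 + y/2)^(-1/2)·(1 − 5y/6)^(-3/2)` of the
degree of the root vertex of the UIPQ. -/
noncomputable def rootDegreeGF (y : ℝ) : ℝ :=
  y / 12 * (1 + y / 2) ^ (-(1 : ℝ) / 2) * (1 - 5 * y / 6) ^ (-(3 : ℝ) / 2)

theorem rd_choose_succ (a : ℝ) (n : ℕ) :
    Ring.choose a (n + 1) = (a - n) / (n + 1) * Ring.choose a n := by
  have h1 := Ring.descPochhammer_eq_factorial_smul_choose a (n + 1)
  have h0 := Ring.descPochhammer_eq_factorial_smul_choose a n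
  rw [descPochhammer_succ_right, Polynomial.smeval_mul, h0] at h1
  simp only [nsmul_eq_mul, Nat.factorial_succ, Polynomial.smeval_sub, Polynomial.smeval_X,
    Polynomial.smeval_natCast, Nat.cast_mul, pow_one, pow_zero] at h1
  have hf : (n ! : ℝ) ≠ 0 := by positivity
  have hn : (n + 1 : ℝ) ≠ 0 := by positivity
  field_simp
  apply mul_left_cancel₀ hf
  push_cast at h1
  linarith

theorem rd_hasSum (a x : ℝ) (hx : |x| < 1) :
    HasSum (fun n : ℕ => Ring.choose a n * x ^ n) ((1 + x) ^ a) := by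
  have h := (Real.one_add_rpow_hasFPowerSeriesOnBall_zero (a := a)).hasSum (y := x)
    (by simpa [enorm_eq_nnnorm, ← NNReal.coe_lt_coe] using hx)
  simpa [binomialSeries, mul_comm] using h

/-- coefficients of `(1-z)^(-3/2)` -/
noncomputable def rdA (k : ℕ) : ℝ := Ring.choose (-(3 : ℝ) / 2) k * (-1) ^ k

/-- absolute values of the coefficients of `(1+3z/5)^(-1/2)` -/
noncomputable def rdB (k : ℕ) : ℝ := Ring.choose (-(1 : ℝ) / 2) k * (-1) ^ k * (3 / 5) ^ k

theorem rdA_zero : rdA 0 = 1 := by simp [rdA]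
theorem rdB_zero : rdB 0 = 1 := by simp [rdB]
theorem rdA_succ (k : ℕ) : rdA (k + 1) = (3 / 2 + k) / (k + 1) * rdA k := by
  simp only [rdA, rd_choose_succ]; ring
theorem rdB_succ (k : ℕ) : rdB (k + 1) = (1 / 2 + k) / (k + 1) * (3 / 5) * rdB k := by
  simp only [rdB, rd_choose_succ]; ring

theorem rdA_pos (k : ℕ) : 0 < rdA k := by
  induction k with
  | zero => simp [rdA_zero]
  | succ k ih => rw [rdA_succ]; positivity
theorem rdB_pos (k : ℕ) : 0 < rdB k := by
  induction k with
  | zero => simp [rdB_zero]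
  | succ k ih => rw [rdB_succ]; positivity

theorem rdA_mono : Monotone rdA := by
  refine monotone_nat_of_le_succ fun k => ?_
  rw [rdA_succ]
  refine le_mul_of_one_le_left (rdA_pos k).le ?_
  rw [one_le_div (by positivity)]; linarith

theorem rdB_anti : Antitone rdB := by
  refine antitone_nat_of_succ_le fun k => ?_
  rw [rdB_succ]
  refine mul_le_of_le_one_left (rdB_pos k).le ?_
  have : (1 / 2 + k : ℝ) / (k + 1) ≤ 1 := by
    rw [div_le_one (by positivity)]; linarith
  linarith

theorem rdA_sq (k : ℕ) : rdA k ^ 2 * Real.Wallis.W k = 2 * k + 1 := by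
  induction k with
  | zero => simp [rdA_zero, Real.Wallis.W]
  | succ k ih =>
    rw [rdA_succ, Real.Wallis.W_succ]
    have : ((3 / 2 + (k:ℝ)) / (k + 1) * rdA k) ^ 2 *
      (Real.Wallis.W k * ((2 * k + 2) / (2 * k + 1) * ((2 * k + 2) / (2 * k + 3)))) =
      (rdA k ^ 2 * Real.Wallis.W k) * (((3 / 2 + (k:ℝ)) / (k + 1)) ^ 2 *
      ((2 * k + 2) / (2 * k + 1) * ((2 * k + 2) / (2 * k + 3)))) := by ring
    rw [this, ih]
    push_cast
    field_simp
    ring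

theorem rd_alt (n : ℕ) : ∀ u : ℕ → ℝ, Antitone u → (∀ i, 0 ≤ u i) →
    0 ≤ ∑ i ∈ Finset.range n, (-1) ^ i * u i ∧ ∑ i ∈ Finset.range n, (-1) ^ i * u i ≤ u 0 := by
  induction n with
  | zero => intro u _ h; simpa using h 0
  | succ n ih =>
    intro u hu h
    obtain ⟨h1, h2⟩ := ih (fun i => u (i + 1)) (fun i j hij => hu (by lia)) (fun i => h _)
    have h3 : u (0 + 1) ≤ u 0 := hu (by lia)
    rw [Finset.sum_range_succ']
    have : ∑ i ∈ Finset.range n, (-1 : ℝ) ^ (i + 1) * u (i + 1) =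
      - ∑ i ∈ Finset.range n, (-1 : ℝ) ^ i * u (i + 1) := by
      rw [← Finset.sum_neg_distrib]
      exact Finset.sum_congr rfl fun i _ => by ring
    rw [this]
    simp only [pow_zero, one_mul]
    constructor <;> linarith

/-- Cauchy product coefficients -/
noncomputable def rdE (k : ℕ) : ℝ := ∑ i ∈ Finset.range (k + 1), (-1) ^ i * (rdB i * rdA (k - i))

theorem rdE_nonneg (k : ℕ) : 0 ≤ rdE k := by
  refine (rd_alt (k + 1) (fun i => rdB i * rdA (k - i)) ?_ ?_).1
  · intro i j hij
    exact mul_le_mul (rdB_anti hij) (rdA_mono (by lia)) (rdA_pos _).le (rdB_pos _).le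
  · intro i
    exact (mul_pos (rdB_pos _) (rdA_pos _)).le

theorem rdA_hasSum (z : ℝ) (hz : |z| < 1) :
    HasSum (fun n => rdA n * z ^ n) ((1 - z) ^ (-(3 : ℝ) / 2)) := by
  have h := rd_hasSum (-(3 : ℝ) / 2) (-z) (by simpa using hz)
  rw [← sub_eq_add_neg] at h
  convert h using 2 with n
  rw [rdA, neg_pow z]; ring

theorem rdB_hasSum (z : ℝ) (hz : |z| < 5 / 3) :
    HasSum (fun n => (-1) ^ n * rdB n * z ^ n) ((1 + 3 / 5 * z) ^ (-(1 : ℝ) / 2)) := by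
  have h := rd_hasSum (-(1 : ℝ) / 2) (3 / 5 * z) (by
    rw [abs_mul, abs_of_pos (by norm_num)]; linarith)
  convert h using 2 with n
  have : ((-1 : ℝ) ^ n) * (-1) ^ n = 1 := by rw [← mul_pow]; simp
  rw [rdB, mul_pow]
  linear_combination (Ring.choose (-(1 : ℝ) / 2) n * (3 / 5) ^ n * z ^ n) * this

theorem rdE_hasSum (z : ℝ) (hz : |z| < 1) :
    HasSum (fun n => rdE n * z ^ n)
      ((1 + 3 / 5 * z) ^ (-(1 : ℝ) / 2) * (1 - z) ^ (-(3 : ℝ) / 2)) := by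
  have hB := rdB_hasSum z (by linarith)
  have hA := rdA_hasSum z hz
  have h := hasSum_sum_range_mul_of_summable_norm hB.summable.norm hA.summable.norm
  rw [hB.tsum_eq, hA.tsum_eq] at h
  convert! h using 2 with n
  simp only [rdE]
  rw [Finset.sum_mul]
  refine Finset.sum_congr rfl fun i hi => ?_
  have : z ^ n = z ^ i * z ^ (n - i) := by
    rw [← pow_add]; congr 1; have := Finset.mem_range.1 hi; lia
  rw [this]; ring

/-- Taylor coefficients -/
noncomputable def rdC : ℕ → ℝ
  | 0 => 0
  | k + 1 => rdE k / 10 * (5 / 6) ^ (k + 1)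

theorem rdC_fps : HasFPowerSeriesAt rootDegreeGF (FormalMultilinearSeries.ofScalars ℝ rdC) 0 := by
  rw [hasFPowerSeriesAt_iff]
  filter_upwards [Metric.ball_mem_nhds (0 : ℝ) one_pos] with y hy
  have hy : |y| < 1 := by simpa using hy
  have h := (rdE_hasSum (5 / 6 * y) (by
    rw [abs_mul, abs_of_pos (by norm_num)]; linarith)).mul_left (y / 12)
  rw [← hasSum_nat_add_iff' 1]
  simp only [FormalMultilinearSeries.coeff_ofScalars, smul_eq_mul, Finset.sum_range_one, rdC,
    zero_add, mul_zero, sub_zero, rootDegreeGF]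
  rw [← mul_assoc, show 1 + 3 / 5 * (5 / 6 * y) = 1 + y / 2 by ring,
    show 1 - 5 / 6 * y = 1 - 5 * y / 6 by ring] at h
  convert! h using 2 with n
  rw [mul_pow]; ring

theorem rdC_eq (k : ℕ) : iteratedDeriv k rootDegreeGF 0 / k ! = rdC k := by
  have h := rdC_fps.eq_formalMultilinearSeries rdC_fps.analyticAt.hasFPowerSeriesAt
  have h2 := congrArg (fun p => FormalMultilinearSeries.coeff p k) h
  simpa using h2.symm

theorem rdC_nonneg (k : ℕ) : 0 ≤ rdC k := by
  cases k with
  | zero => simp [rdC]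
  | succ k => have := rdE_nonneg k; simp only [rdC]; positivity

theorem rdA_ratio_one : Tendsto (fun k => rdA k / rdA (k + 1)) atTop (nhds 1) := by
  have h : Tendsto (fun k : ℕ => (1 + 1 * (k : ℝ)) / (3 / 2 + 1 * k)) atTop (nhds (1 / 1)) := by
    exact tendsto_add_mul_div_add_mul_atTop_nhds (1 : ℝ) (3 / 2) 1 one_ne_zero
  rw [div_one] at h
  refine h.congr fun k => ?_
  rw [rdA_succ]
  have := (rdA_pos k).ne'
  field_simp
  ring

theorem rdA_ratio (i : ℕ) : Tendsto (fun k => rdA k / rdA (k + i)) atTop (nhds 1) := by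
  induction i with
  | zero => simp [(rdA_pos _).ne']
  | succ i ih =>
    have h := ih.mul ((tendsto_add_atTop_iff_nat i).2 rdA_ratio_one)
    rw [one_mul] at h
    refine h.congr fun k => ?_
    have := (rdA_pos (k + i)).ne'
    rw [← add_assoc]
    field_simp

theorem rdE_lim : Tendsto (fun k => rdE k / rdA k) atTop (nhds ((8 / 5) ^ (-(1 : ℝ) / 2))) := by
  have hs := rdB_hasSum 1 (by norm_num)
  norm_num only [one_pow, mul_one] at hs
  have hs' : HasSum (fun n => (-1) ^ n * rdB n) ((8 / 5) ^ (-(1 : ℝ) / 2)) := by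
    convert hs using 2; norm_num
  rw [← hs'.tsum_eq]
  have key := tendsto_tsum_of_dominated_convergence (𝓕 := atTop)
    (f := fun (k : ℕ) (i : ℕ) => if i ∈ Finset.range (k + 1) then
      (-1) ^ i * rdB i * (rdA (k - i) / rdA k) else 0)
    (g := fun n => (-1) ^ n * rdB n) (bound := fun n => ‖(-1) ^ n * rdB n‖)
    hs'.summable.norm ?_ ?_
  · refine key.congr fun k => ?_
    rw [tsum_eq_sum (s := Finset.range (k + 1)) (fun i hi => if_neg hi), rdE, Finset.sum_div]
    refine Finset.sum_congr rfl fun i hi => ?_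
    rw [if_pos hi]; ring
  · intro i
    rw [← tendsto_add_atTop_iff_nat i]
    have h := (rdA_ratio i).const_mul ((-1) ^ i * rdB i)
    rw [mul_one] at h
    refine h.congr fun k => ?_
    rw [if_pos (by simp), Nat.add_sub_cancel]
  · refine Eventually.of_forall fun k i => ?_
    split_ifs
    · rw [norm_mul]
      refine mul_le_of_le_one_right (norm_nonneg _) ?_
      rw [Real.norm_of_nonneg (div_pos (rdA_pos _) (rdA_pos _)).le, div_le_one (rdA_pos _)]
      exact rdA_mono (by lia)
    · simp

theorem rdA_lim : Tendsto (fun k : ℕ => rdA k * Real.sqrt (40 * π / (k + 1 : ℕ))) atTop (nhds (Real.sqrt 160)) := by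
  have h1 : Tendsto (fun k : ℕ => (1 + 2 * (k : ℝ)) / (1 + 1 * k)) atTop (nhds (2 / 1)) :=
    tendsto_add_mul_div_add_mul_atTop_nhds (1 : ℝ) 1 2 one_ne_zero
  have h2 := (h1.mul ((Real.Wallis.tendsto_W_nhds_pi_div_two.inv₀ (by positivity)).const_mul
    (40 * π))).sqrt
  have : 2 / 1 * (40 * π * (π / 2)⁻¹) = 160 := by field_simp; norm_num
  rw [this] at h2
  refine h2.congr fun k => ?_
  rw [← Real.sqrt_sq (rdA_pos k).le, ← Real.sqrt_mul (by positivity)]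
  congr 1
  have hW := Real.Wallis.W_pos k
  have h := rdA_sq k
  rw [eq_div_of_mul_eq hW.ne' h]
  push_cast
  field_simp
  ring

/-- `g` is analytic at `0`, its Taylor coefficients `c_k = g^{(k)}(0)/k!` are nonnegative,
and `c_k · (6/5)^k · √(40π/k) → 1` as `k → ∞`, i.e. `c_k ~ √(k/(40π))·(5/6)^k`. -/
theorem rootDegreeGF_coeff_asymptotics :
    AnalyticAt ℝ rootDegreeGF 0 ∧
    (∀ k : ℕ, 0 ≤ iteratedDeriv k rootDegreeGF 0 / k !) ∧
    Tendsto (fun k : ℕ =>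
        iteratedDeriv k rootDegreeGF 0 / k ! * (6 / 5) ^ k * Real.sqrt (40 * π / k))
      atTop (nhds 1) := by
  refine ⟨rdC_fps.analyticAt, fun k => by rw [rdC_eq]; exact rdC_nonneg k, ?_⟩
  simp only [rdC_eq]
  rw [← tendsto_add_atTop_iff_nat 1]
  have h := (rdE_lim.mul rdA_lim).mul_const (1 / 10)
  have hc : (8 / 5 : ℝ) ^ (-(1 : ℝ) / 2) * Real.sqrt 160 * (1 / 10) = 1 := by
    rw [neg_div, Real.rpow_neg (by norm_num), ← Real.sqrt_eq_rpow, ← Real.sqrt_inv,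
      ← Real.sqrt_mul (by norm_num)]
    rw [show ((8 / 5 : ℝ)⁻¹ * 160) = 10 ^ 2 by norm_num, Real.sqrt_sq (by norm_num)]
    norm_num
  rw [hc] at h
  refine h.congr fun k => ?_
  have h1 := (rdA_pos k).ne'
  have h2 : (5 / 6 : ℝ) ^ (k + 1) * (6 / 5) ^ (k + 1) = 1 := by
    rw [← mul_pow]; norm_num
  simp only [rdC]
  generalize Real.sqrt (40 * π / (k + 1 : ℕ)) = s
  have h3 : rdE k / rdA k * (rdA k * s) * (1 / 10) = rdE k / 10 * s := by field_simp
  rw [h3]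
  linear_combination (-(rdE k / 10 * s)) * h2
end
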